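/- Let n ≥ 1 and let s ∈ {0,1}^{4n} be any of the six strings 0^{4n}, 1^{4n}, 0^{2n}1^{2n}, 1^{2n}0^{2n}, 0^n1^n0^n1^n, 1^n0^n1^n0^n. Then for every y ∈ {0,1}^{4n} satisfying |y| = 2n, Σ_{i=1}^{2n} y_i = n, and Σ_{i=1}^n y_i + Σ_{i=2n+1}^{3n} y_i = n, the Hamming distance |{i ∈ {1,…,4n} : s_i ≠ y_i}| equals 2n. Consequently, the function f_5 satisfies condition (B) with coefficients c_0 = 0 and c_i = 1/(4n) for 1 ≤ i ≤ 4n. -/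

import Mathlib

/-- The Hamming weight of a Boolean string. -/
def wt {n : ℕ} (x : Fin n → Bool) : ℕ := (Finset.univ.filter (fun i => x i)).card

/-- The six strings `0^{4n}, 1^{4n}, 0^{2n}1^{2n}, 1^{2n}0^{2n}, 0^n1^n0^n1^n, 1^n0^n1^n0^n`
on which `f₅` takes value 1 (positions are 0-based). -/
def f5Ones (n : ℕ) : Set (Fin (4 * n) → Bool) :=
  {fun _ => false, fun _ => true,
   fun i => decide (2 * n ≤ i.val), fun i => decide (i.val < 2 * n),
   fun i => decide (i.val / n % 2 = 1), fun i => decide (i.val / n % 2 = 0)}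

/-- The condition defining the strings on which `f₅` takes value 0:
`|y| = 2n`, `Σ_{i=1}^{2n} y_i = n`, and `Σ_{i=1}^n y_i + Σ_{i=2n+1}^{3n} y_i = n`. -/
def f5ZeroCond (n : ℕ) (y : Fin (4 * n) → Bool) : Prop :=
  wt y = 2 * n ∧
  (Finset.univ.filter (fun i : Fin (4 * n) => y i ∧ i.val < 2 * n)).card = n ∧
  (Finset.univ.filter
    (fun i : Fin (4 * n) => y i ∧ (i.val < n ∨ (2 * n ≤ i.val ∧ i.val < 3 * n)))).card = n

/-- `|s ⊕ y| + 2 |s ∧ y| = |s| + |y|` for Boolean strings. -/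
theorem card_ne_add_two_mul_card_and {ι : Type*} [Fintype ι] (s y : ι → Bool) :
    (Finset.univ.filter (fun i => s i ≠ y i)).card +
        2 * (Finset.univ.filter (fun i => y i ∧ s i)).card =
      (Finset.univ.filter (fun i => s i)).card + (Finset.univ.filter (fun i => y i)).card := by
  simp only [Finset.card_filter, Finset.mul_sum, ← Finset.sum_add_distrib]
  refine Finset.sum_congr rfl fun i _ => ?_
  cases s i <;> cases y i <;> rfl

/-- The distances from `y` to `s` and to the complement of `s` add up to the length. -/
theorem card_ne_add_card_not_ne {ι : Type*} [Fintype ι] (s y : ι → Bool) :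
    (Finset.univ.filter (fun i => s i ≠ y i)).card +
        (Finset.univ.filter (fun i => (!s i) ≠ y i)).card = Fintype.card ι := by
  rw [Fintype.card_eq_sum_ones]
  simp only [Finset.card_filter, ← Finset.sum_add_distrib]
  refine Finset.sum_congr rfl fun i _ => ?_
  cases s i <;> cases y i <;> rfl

theorem Fin.card_filter_val {m : ℕ} (p : ℕ → Prop) [DecidablePred p] :
    (Finset.univ.filter (fun i : Fin m => p i.val)).card = ((Finset.range m).filter p).card := by
  simp only [Finset.card_filter]
  exact Fin.sum_univ_eq_sum_range (fun i => if p i then 1 else 0) m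

theorem card_first_half (n : ℕ) :
    (Finset.univ.filter (fun i : Fin (4 * n) => i.val < 2 * n)).card = 2 * n := by
  rw [Fin.card_filter_val (fun i => i < 2 * n)]
  have h : (Finset.range (4 * n)).filter (fun i => i < 2 * n) = Finset.range (2 * n) := by
    ext i
    simp only [Finset.mem_filter, Finset.mem_range]
    omega
  rw [h, Finset.card_range]

theorem card_even_blocks (n : ℕ) :
    (Finset.univ.filter (fun i : Fin (4 * n) =>
      i.val < n ∨ (2 * n ≤ i.val ∧ i.val < 3 * n))).card = 2 * n := by
  rw [Fin.card_filter_val (fun i => i < n ∨ (2 * n ≤ i ∧ i < 3 * n))]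
  have h : (Finset.range (4 * n)).filter (fun i => i < n ∨ (2 * n ≤ i ∧ i < 3 * n)) =
      Finset.range n ∪ Finset.Ico (2 * n) (3 * n) := by
    ext i
    simp only [Finset.mem_filter, Finset.mem_range, Finset.mem_union, Finset.mem_Ico]
    omega
  rw [h, Finset.card_union_of_disjoint, Finset.card_range, Nat.card_Ico]
  · omega
  · rw [Finset.disjoint_left]
    intro i
    simp only [Finset.mem_range, Finset.mem_Ico]
    omega

theorem div_mod_two_eq_zero_iff {n i : ℕ} (hi : i < 4 * n) :
    i / n % 2 = 0 ↔ i < n ∨ (2 * n ≤ i ∧ i < 3 * n) := by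
  have hn : 0 < n := by omega
  have h1 := Nat.div_lt_iff_lt_mul (x := i) (y := 1) hn
  have h2 := Nat.le_div_iff_mul_le (x := 2) (y := i) hn
  have h3 := Nat.div_lt_iff_lt_mul (x := i) (y := 3) hn
  have h4 := Nat.div_lt_iff_lt_mul (x := i) (y := 4) hn
  generalize i / n = q at *
  omega

/-- Every string in `f5Ones n` is at Hamming distance `2 * n` from every zero of `f₅`. -/
theorem card_ne_of_mem_f5Ones {n : ℕ} {s y : Fin (4 * n) → Bool} (hs : s ∈ f5Ones n)
    (hy : f5ZeroCond n y) : (Finset.univ.filter (fun i => s i ≠ y i)).card = 2 * n := by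
  obtain ⟨hw, hhalf, hblocks⟩ := hy
  unfold wt at hw
  have hcompl (t : Fin (4 * n) → Bool)
      (ht : (Finset.univ.filter (fun i => t i ≠ y i)).card = 2 * n) :
      (Finset.univ.filter (fun i => (!t i) ≠ y i)).card = 2 * n := by
    have h := card_ne_add_card_not_ne t y
    rw [Fintype.card_fin] at h
    omega
  have hzero : (Finset.univ.filter (fun i => false ≠ y i)).card = 2 * n := by
    simpa only [ne_eq, Bool.false_eq, Bool.not_eq_false] using hw
  have hfirst : (Finset.univ.filter
      (fun i : Fin (4 * n) => decide (i.val < 2 * n) ≠ y i)).card = 2 * n := by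
    have h := card_ne_add_two_mul_card_and (fun i : Fin (4 * n) => decide (i.val < 2 * n)) y
    simp only [decide_eq_true_eq] at h
    rw [hhalf, hw, card_first_half] at h
    omega
  have heven : (Finset.univ.filter
      (fun i : Fin (4 * n) => decide (i.val / n % 2 = 0) ≠ y i)).card = 2 * n := by
    have h := card_ne_add_two_mul_card_and (fun i : Fin (4 * n) => decide (i.val / n % 2 = 0)) y
    simp only [decide_eq_true_eq, div_mod_two_eq_zero_iff (Fin.is_lt _)] at h
    rw [hblocks, hw, card_even_blocks] at h
    simp only [div_mod_two_eq_zero_iff (Fin.is_lt _)]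
    omega
  rcases hs with rfl | rfl | rfl | rfl | rfl | rfl
  · exact hzero
  · exact hcompl _ hzero
  · simpa only [← decide_not, not_lt] using hcompl _ hfirst
  · exact hfirst
  · simpa only [← decide_not, Nat.mod_two_not_eq_zero] using hcompl _ heven
  · exact heven

theorem stmt13 (n : ℕ) (hn : 1 ≤ n) :
    (∀ s ∈ f5Ones n, ∀ y : Fin (4 * n) → Bool, f5ZeroCond n y →
      (Finset.univ.filter (fun i => s i ≠ y i)).card = 2 * n) ∧
    (∀ x y : Fin (4 * n) → Bool,
      ((x ∈ f5Ones n ∧ f5ZeroCond n y) ∨ (y ∈ f5Ones n ∧ f5ZeroCond n x)) →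
      (∑ _i ∈ Finset.univ.filter (fun i => x i ≠ y i), (1 / (4 * (n : ℝ)))) = 1 / 2) := by
  refine ⟨fun s hs y hy => card_ne_of_mem_f5Ones hs hy, fun x y h => ?_⟩
  have hcard : (Finset.univ.filter (fun i => x i ≠ y i)).card = 2 * n := by
    rcases h with ⟨hx, hy⟩ | ⟨hy, hx⟩
    · exact card_ne_of_mem_f5Ones hx hy
    · simpa only [ne_comm] using card_ne_of_mem_f5Ones hy hx
  have hn0 : (n : ℝ) ≠ 0 := by positivity
  rw [Finset.sum_const, hcard, nsmul_eq_mul]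
  push_cast
  field_simp
  norm_num
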